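/- Every finite simple graph of maximum degree at most 4 admits a strong edge-colouring using at most 22 colours, i.e., there exists a strong edge-colouring γ of G whose colours are taken from a set of size 22. -/

import Mathlib

/-- A strong edge-colouring of a simple graph `G`: an assignment `γ` of colours to the edges
such that any two distinct edges which share an endpoint, or an endpoint of one of which is
joined by an edge of `G` to an endpoint of the other (i.e. edges lying on a common path of
length three), receive different colours. -/
def IsStrongEdgeColoring {V C : Type*} (G : SimpleGraph V) (γ : Sym2 V → C) : Prop :=
  ∀ e ∈ G.edgeSet, ∀ f ∈ G.edgeSet, e ≠ f →
    ((∃ z : V, z ∈ e ∧ z ∈ f) ∨ (∃ x ∈ e, ∃ y ∈ f, G.Adj x y)) → γ e ≠ γ f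

namespace StrongEdgeColoring

open Finset
open scoped Classical

variable {V : Type*} {G : SimpleGraph V}

/-- Two edges conflict when they share an endpoint or are joined by an edge of `G`. -/
def Conflict (G : SimpleGraph V) (e f : Sym2 V) : Prop :=
  (∃ z : V, z ∈ e ∧ z ∈ f) ∨ (∃ x ∈ e, ∃ y ∈ f, G.Adj x y)

theorem Conflict.symm {e f : Sym2 V} (h : Conflict G e f) : Conflict G f e := by
  rcases h with ⟨z, h₁, h₂⟩ | ⟨x, hx, y, hy, h⟩
  · exact Or.inl ⟨z, h₂, h₁⟩
  · exact Or.inr ⟨y, hy, x, hx, h.symm⟩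

/-- `γ` restricted to the edges in `D` is a strong edge-colouring. -/
def IsPartialColoring {C : Type*} (G : SimpleGraph V) (D : Finset (Sym2 V)) (γ : Sym2 V → C) :
    Prop :=
  ∀ e ∈ D, ∀ f ∈ D, e ≠ f → Conflict G e f → γ e ≠ γ f

theorem exists_mem_of_conflict {t y : V} {f : Sym2 V} (hty : G.Adj t y) (hf : f ∈ G.edgeSet)
    (hne : f ≠ s(t, y)) (h : Conflict G s(t, y) f) :
    ∃ p ∈ f, p ≠ t ∧ p ≠ y ∧ (G.Adj t p ∨ G.Adj y p) := by
  induction f using Sym2.ind with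
  | _ a b =>
    simp only [SimpleGraph.mem_edgeSet] at hf
    have := hf.ne
    have := hty.ne
    have hba := hf.symm
    simp only [ne_eq, Sym2.eq_iff, not_or, not_and] at hne
    simp only [Conflict, Sym2.mem_iff] at h ⊢
    rcases h with ⟨z, rfl | rfl, rfl | rfl⟩ | ⟨x, rfl | rfl, z, rfl | rfl, h⟩ <;> grind

/-- A colouring extends to a further edge that sees fewer colours than are available. -/
theorem IsPartialColoring.exists_insert {C : Type*} [Fintype C] [DecidableEq C]
    {D : Finset (Sym2 V)} {γ : Sym2 V → C} (h : IsPartialColoring G D γ) {e : Sym2 V} (he : e ∉ D)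
    (hc : #({f ∈ D | Conflict G e f}.image γ) < Fintype.card C) :
    ∃ γ' : Sym2 V → C, (∀ f ∈ D, γ' f = γ f) ∧ IsPartialColoring G (insert e D) γ' := by
  obtain ⟨c, hc⟩ : ∃ c, c ∉ {f ∈ D | Conflict G e f}.image γ := by
    by_contra! hall
    rw [← card_univ, eq_univ_of_forall hall] at hc
    exact lt_irrefl _ hc
  have hγ : ∀ f ∈ D, Function.update γ e c f = γ f := fun f hf ↦
    Function.update_of_ne (by rintro rfl; exact he hf) _ _
  have hcf : ∀ f ∈ D, Conflict G e f → c ≠ γ f := by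
    rintro f hf hef rfl
    exact hc (mem_image_of_mem γ (mem_filter.2 ⟨hf, hef⟩))
  refine ⟨Function.update γ e c, hγ, fun f hf g hg hne hfg ↦ ?_⟩
  rcases mem_insert.1 hf with rfl | hfD <;> rcases mem_insert.1 hg with rfl | hgD
  · exact absurd rfl hne
  · rw [hγ g hgD, Function.update_self]
    exact hcf g hgD hfg
  · rw [hγ f hfD, Function.update_self]
    exact (hcf f hfD hfg.symm).symm
  · rw [hγ f hfD, hγ g hgD]
    exact h f hfD g hgD hne hfg

/-- Greedy colouring along a degeneracy order. -/
theorem IsPartialColoring.exists_union {C : Type*} [Fintype C] {P : Finset (Sym2 V)}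
    {κ : Sym2 V → C} (hP : IsPartialColoring G P κ) (S : Finset (Sym2 V)) (hPS : Disjoint P S)
    (h : ∀ T ⊆ S, T.Nonempty →
      ∃ e ∈ T, #{f ∈ P ∪ T | f ≠ e ∧ Conflict G e f} < Fintype.card C) :
    ∃ γ : Sym2 V → C, (∀ p ∈ P, γ p = κ p) ∧ IsPartialColoring G (P ∪ S) γ := by
  induction S using Finset.strongInduction with
  | H S ih =>
    rcases S.eq_empty_or_nonempty with rfl | hS
    · exact ⟨κ, fun _ _ ↦ rfl, by simpa using hP⟩
    · obtain ⟨e, heS, he⟩ := h S subset_rfl hS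
      obtain ⟨γ, hγ, hpart⟩ := ih (S.erase e) (erase_ssubset heS)
        (hPS.mono_right (erase_subset _ _))
        (fun T hT ↦ h T (hT.trans (erase_subset _ _)))
      have heP : e ∉ P := fun hp ↦ disjoint_left.1 hPS hp heS
      obtain ⟨γ', hγ', hpart'⟩ := hpart.exists_insert (e := e) (by simp [heP]) (by
        refine lt_of_le_of_lt (card_image_le.trans (card_le_card ?_)) he
        intro f hf
        simp only [mem_filter, mem_union, mem_erase] at hf ⊢
        refine ⟨by tauto, ?_, hf.2⟩
        rintro rfl
        tauto)
      refine ⟨γ', fun p hp ↦ ?_, ?_⟩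
      · rw [hγ' p (mem_union_left _ hp), hγ p hp]
      · convert hpart' using 1
        rw [← union_insert, insert_erase heS]

/-- Colouring the edges of a list one after the other. -/
theorem IsPartialColoring.exists_union_list {C : Type*} [Fintype C] [DecidableEq C]
    (l : List (Sym2 V)) {D : Finset (Sym2 V)} {γ : Sym2 V → C}
    (h : IsPartialColoring G D γ) (hl : l.Nodup)
    (hD : ∀ e ∈ l, e ∉ D)
    (hc : ∀ (i : ℕ) (hi : i < l.length),
      #({f ∈ D | Conflict G l[i] f}.image γ) + i < Fintype.card C) :
    ∃ γ' : Sym2 V → C, IsPartialColoring G (D ∪ l.toFinset) γ' := by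
  induction l generalizing D γ with
  | nil => exact ⟨γ, by simpa using h⟩
  | cons e l ih =>
    obtain ⟨γ', hγ', hpart⟩ := h.exists_insert (hD e (by simp)) (hc 0 (Nat.succ_pos _))
    obtain ⟨hel, hl⟩ := List.nodup_cons.1 hl
    obtain ⟨δ, hδ⟩ := ih hpart hl
      (fun f hf ↦ by
        have := hD f (by simp [hf])
        have : f ≠ e := by rintro rfl; exact hel hf
        simp [*])
      (fun i hi ↦ by
        have hi' := hc (i + 1) (by simpa using hi)
        simp only [List.getElem_cons_succ] at hi'
        have hsub : ({f ∈ insert e D | Conflict G l[i] f}.image γ') ⊆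
            insert (γ' e) ({f ∈ D | Conflict G l[i] f}.image γ) := by
          intro c hc
          simp only [mem_image, mem_filter, mem_insert] at hc ⊢
          obtain ⟨f, ⟨rfl | hf, hcf⟩, rfl⟩ := hc
          · exact Or.inl rfl
          · exact Or.inr ⟨f, ⟨hf, hcf⟩, (hγ' f hf).symm⟩
        have := (card_le_card hsub).trans (card_insert_le _ _)
        omega)
    refine ⟨δ, ?_⟩
    convert hδ using 1
    ext f
    simp only [mem_union, List.mem_toFinset, List.mem_cons, mem_insert]
    tauto

/-- Strong edge-colourings of the connected components combine. -/
theorem exists_coloring_of_forall_component {C : Type*} [Inhabited C]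
    (h : ∀ c : G.ConnectedComponent, ∃ γ : Sym2 c → C, IsStrongEdgeColoring c.toSimpleGraph γ) :
    ∃ γ : Sym2 V → C, IsStrongEdgeColoring G γ := by
  choose γ hγ using h
  have huniq : ∀ p q : (c : G.ConnectedComponent) × Sym2 c,
      p.2.map Subtype.val = q.2.map Subtype.val → p = q := by
    rintro ⟨c, e⟩ ⟨d, f⟩ hef
    obtain rfl : c = d := by
      induction e using Sym2.ind with
      | _ x y =>
        have hx : x.val ∈ f.map Subtype.val := hef ▸ by simp
        obtain ⟨z, -, hz⟩ := Sym2.mem_map.1 hx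
        exact SimpleGraph.ConnectedComponent.eq_of_common_vertex x.2 (hz ▸ z.2)
    exact congrArg (Sigma.mk c) (Sym2.map.injective Subtype.val_injective hef)
  obtain ⟨δ, hδ⟩ : ∃ δ : Sym2 V → C, ∀ (c : G.ConnectedComponent) (e : Sym2 c),
      δ (e.map Subtype.val) = γ c e := by
    refine ⟨fun e ↦ if h : ∃ p : (c : G.ConnectedComponent) × Sym2 c, p.2.map Subtype.val = e
      then γ h.choose.1 h.choose.2 else default, fun c e ↦ ?_⟩
    have h : ∃ p : (c : G.ConnectedComponent) × Sym2 c,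
      p.2.map Subtype.val = e.map Subtype.val := ⟨⟨c, e⟩, rfl⟩
    refine (dif_pos h).trans ?_
    rw [huniq h.choose ⟨c, e⟩ h.choose_spec]
  refine ⟨δ, fun e he f hf hne hef ↦ ?_⟩
  induction e using Sym2.ind with
  | _ a b =>
    induction f using Sym2.ind with
    | _ x y =>
      rw [SimpleGraph.mem_edgeSet] at he hf
      have hx : G.Reachable x a := by
        rcases hef with ⟨z, hz, hz'⟩ | ⟨z, hz, z', hz', hzz⟩
        · rw [Sym2.mem_iff] at hz hz'
          rcases hz with rfl | rfl <;> rcases hz' with rfl | rfl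
          exacts [.rfl, hf.reachable, he.symm.reachable, hf.reachable.trans he.symm.reachable]
        · rw [Sym2.mem_iff] at hz hz'
          have h₁ : G.Reachable z a := by
            rcases hz with rfl | rfl
            exacts [.rfl, he.symm.reachable]
          have h₂ : G.Reachable x z' := by
            rcases hz' with rfl | rfl
            exacts [.rfl, hf.reachable]
          exact (h₂.trans hzz.symm.reachable).trans h₁
      have hmem {u : V} (hu : G.Reachable u a) : u ∈ G.connectedComponentMk a :=
        SimpleGraph.ConnectedComponent.sound hu
      let a' : G.connectedComponentMk a := ⟨a, hmem .rfl⟩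
      let b' : G.connectedComponentMk a := ⟨b, hmem he.symm.reachable⟩
      let x' : G.connectedComponentMk a := ⟨x, hmem hx⟩
      let y' : G.connectedComponentMk a := ⟨y, hmem (hf.symm.reachable.trans hx)⟩
      have key := hγ _ s(a', b') he s(x', y') hf
        (fun h ↦ hne (congrArg (Sym2.map Subtype.val) h)) (by
          rcases hef with ⟨z, hz, hz'⟩ | ⟨z, hz, z', hz', hzz⟩
          · obtain ⟨u, hu, rfl⟩ := Sym2.mem_map.1
              (show z ∈ Sym2.map Subtype.val s(a', b') from hz)
            obtain ⟨w, hw, huw⟩ := Sym2.mem_map.1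
              (show u.val ∈ Sym2.map Subtype.val s(x', y') from hz')
            exact Or.inl ⟨u, hu, Subtype.ext huw ▸ hw⟩
          · obtain ⟨u, hu, rfl⟩ := Sym2.mem_map.1
              (show z ∈ Sym2.map Subtype.val s(a', b') from hz)
            obtain ⟨w, hw, rfl⟩ := Sym2.mem_map.1
              (show z' ∈ Sym2.map Subtype.val s(x', y') from hz')
            exact Or.inr ⟨u, hu, w, hw, hzz⟩)
      rwa [← hδ, ← hδ] at key

/-- In a graph of girth at least five, pairs of vertices at distance two from `v` behind three
neighbours of `v` have an independent transversal. -/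
theorem exists_independent_transversal
    (htri : ∀ a b c, G.Adj a b → G.Adj b c → ¬ G.Adj a c)
    (hsq : ∀ x w y z, x ≠ w → y ≠ z → G.Adj w y → G.Adj w z → G.Adj x y → ¬ G.Adj x z)
    {v p q r : V} (hp : G.Adj v p) (hq : G.Adj v q) (hr : G.Adj v r) {B C D : Finset V}
    (hB : 1 < #B) (hC : 1 < #C) (hD : 1 < #D) (hpB : ∀ x ∈ B, G.Adj p x)
    (hqC : ∀ x ∈ C, G.Adj q x) (hrD : ∀ x ∈ D, G.Adj r x) :
    ∃ b ∈ B, ∃ c ∈ C, ∃ d ∈ D, ¬ G.Adj b c ∧ ¬ G.Adj b d ∧ ¬ G.Adj c d := by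
  obtain ⟨b, hb, b', hb', hbb⟩ := one_lt_card.1 hB
  obtain ⟨c, hc, c', hc', hcc⟩ := one_lt_card.1 hC
  obtain ⟨d, hd, d', hd', hdd⟩ := one_lt_card.1 hD
  have hm : ∀ u u' x y z, G.Adj v u → G.Adj v u' → G.Adj u x → y ≠ z → G.Adj u' y →
      G.Adj u' z → G.Adj x y → ¬ G.Adj x z := by
    refine fun u u' x y z hu hu' hx hyz hy hz ↦ hsq x u' y z ?_ hyz hy hz
    rintro rfl
    exact htri _ _ _ hu hx hu'
  have hBC : ∀ x ∈ B, G.Adj x c → ¬ G.Adj x c' := fun x hx ↦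
    hm p q x c c' hp hq (hpB x hx) hcc (hqC c hc) (hqC c' hc')
  have hBD : ∀ x ∈ B, G.Adj x d → ¬ G.Adj x d' := fun x hx ↦
    hm p r x d d' hp hr (hpB x hx) hdd (hrD d hd) (hrD d' hd')
  have hCD : ∀ x ∈ C, G.Adj x d → ¬ G.Adj x d' := fun x hx ↦
    hm q r x d d' hq hr (hqC x hx) hdd (hrD d hd) (hrD d' hd')
  have hCB : ∀ x ∈ C, G.Adj b x → ¬ G.Adj b' x := fun x hx h h' ↦
    hm q p x b b' hq hp (hqC x hx) hbb (hpB b hb) (hpB b' hb') h.symm h'.symm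
  have hDB : ∀ x ∈ D, G.Adj b x → ¬ G.Adj b' x := fun x hx h h' ↦
    hm r p x b b' hr hp (hrD x hx) hbb (hpB b hb) (hpB b' hb') h.symm h'.symm
  have hDC : ∀ x ∈ D, G.Adj c x → ¬ G.Adj c' x := fun x hx h h' ↦
    hm r q x c c' hr hq (hrD x hx) hcc (hqC c hc) (hqC c' hc') h.symm h'.symm
  have h₁ := htri b c d
  have h₂ := htri b c d'
  have h₃ := htri b c' d
  have h₄ := htri b c' d'
  have h₅ := htri b' c d
  have h₆ := htri b' c d'
  have h₇ := htri b' c' d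
  have h₈ := htri b' c' d'
  by_contra! h
  have k₁ := h b hb c hc d hd
  have k₂ := h b hb c hc d' hd'
  have k₃ := h b hb c' hc' d hd
  have k₄ := h b hb c' hc' d' hd'
  have k₅ := h b' hb' c hc d hd
  have k₆ := h b' hb' c hc d' hd'
  have k₇ := h b' hb' c' hc' d hd
  have k₈ := h b' hb' c' hc' d' hd'
  replace hBC := And.intro (hBC b hb) (hBC b' hb')
  replace hBD := And.intro (hBD b hb) (hBD b' hb')
  replace hCD := And.intro (hCD c hc) (hCD c' hc')
  replace hCB := And.intro (hCB c hc) (hCB c' hc')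
  replace hDB := And.intro (hDB d hd) (hDB d' hd')
  replace hDC := And.intro (hDC d hd) (hDC d' hd')
  clear htri hsq hm h hpB hqC hrD
  grind +splitImp (splits := 30)

variable [Fintype V]

/-- The edges avoiding `v` which conflict with the edge `s(v, w)`. -/
noncomputable def farConflicts (G : SimpleGraph V) (v w : V) : Finset (Sym2 V) :=
  {f ∈ G.edgeFinset | v ∉ f ∧ Conflict G s(v, w) f}

/-- The edges at `p` avoiding `v`. -/
noncomputable def edgesAvoiding (G : SimpleGraph V) (v p : V) : Finset (Sym2 V) :=
  {f ∈ G.incidenceFinset p | v ∉ f}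

theorem mem_edgesAvoiding {v p : V} {f : Sym2 V} :
    f ∈ edgesAvoiding G v p ↔ f ∈ G.edgeSet ∧ p ∈ f ∧ v ∉ f := by
  simp [edgesAvoiding, SimpleGraph.mem_incidenceFinset, SimpleGraph.incidenceSet, and_assoc]

theorem card_edgesAvoiding_le (hdeg : ∀ v, G.degree v ≤ 4) (v p : V) :
    #(edgesAvoiding G v p) ≤ 4 :=
  (card_filter_le _ _).trans (by simpa using hdeg p)

theorem card_edgesAvoiding_le_of_adj (hdeg : ∀ v, G.degree v ≤ 4) {v p : V} (h : G.Adj v p) :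
    #(edgesAvoiding G v p) ≤ 3 := by
  have hsub : edgesAvoiding G v p ⊆ (G.incidenceFinset p).erase s(v, p) := by
    intro f hf
    rw [edgesAvoiding, mem_filter] at hf
    refine mem_erase.2 ⟨?_, hf.1⟩
    rintro rfl
    simp at hf
  have hmem : s(v, p) ∈ G.incidenceFinset p := by
    simp [SimpleGraph.mem_incidenceFinset, SimpleGraph.incidenceSet, h]
  have := card_le_card hsub
  rw [card_erase_of_mem hmem, SimpleGraph.card_incidenceFinset_eq_degree] at this
  have := hdeg p
  omega

theorem farConflicts_subset {v w : V} (h : G.Adj v w) :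
    farConflicts G v w ⊆ ((G.neighborFinset v).erase w).biUnion (edgesAvoiding G v) ∪
      ((G.neighborFinset w).erase v).biUnion (edgesAvoiding G v) := by
  intro f hf
  simp only [farConflicts, mem_filter, SimpleGraph.mem_edgeFinset] at hf
  obtain ⟨hf, hvf, hc⟩ := hf
  obtain ⟨p, hp, h₁, h₂, h₃⟩ := exists_mem_of_conflict h hf
    (by rintro rfl; simp at hvf) hc
  simp only [mem_union, mem_biUnion, mem_erase, SimpleGraph.mem_neighborFinset,
    mem_edgesAvoiding]
  rcases h₃ with h₃ | h₃
  · exact Or.inl ⟨p, ⟨h₂, h₃⟩, hf, hp, hvf⟩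
  · exact Or.inr ⟨p, ⟨h₁, h₃⟩, hf, hp, hvf⟩

theorem card_biUnion_right_le (hdeg : ∀ v, G.degree v ≤ 4) {v w : V} (h : G.Adj v w) :
    #(((G.neighborFinset w).erase v).biUnion (edgesAvoiding G v)) ≤ 12 := by
  refine (card_biUnion_le_card_mul _ _ 4 fun p _ ↦ card_edgesAvoiding_le hdeg v p).trans ?_
  rw [card_erase_of_mem (by simpa using h.symm), SimpleGraph.card_neighborFinset_eq_degree]
  have := hdeg w
  omega

theorem card_biUnion_left_le (hdeg : ∀ v, G.degree v ≤ 4) {v w : V} (h : G.Adj v w) :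
    #(((G.neighborFinset v).erase w).biUnion (edgesAvoiding G v)) ≤ (G.degree v - 1) * 3 := by
  refine (card_biUnion_le_card_mul _ _ 3 fun p hp ↦
    card_edgesAvoiding_le_of_adj hdeg (by simpa using (mem_erase.1 hp).2)).trans ?_
  rw [card_erase_of_mem (by simpa using h), SimpleGraph.card_neighborFinset_eq_degree]

/-- Rooted colouring: the stubs `s(w, φ w)` with `w ∈ J` are coloured in advance by `c`, those
with `w ∈ J₀` repeat a colour; then edges are coloured towards `v`, those at `v` in the order
given by `l`. -/
theorem exists_coloring_of_root (hG : G.Preconnected) (hdeg : ∀ v, G.degree v ≤ 4) (v : V)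
    (J J₀ : Finset V) (φ : V → V) (c : V → Fin 22) (hJ₀ : J₀ ⊆ J)
    (hJ : ∀ w ∈ J, G.Adj v w ∧ G.Adj w (φ w) ∧ φ w ≠ v ∧ ¬ G.Adj v (φ w))
    (hφ : ∀ w ∈ J, ∀ w' ∈ J, φ w = φ w' → w = w')
    (hc : ∀ w ∈ J, ∀ w' ∈ J, w ≠ w' → c w = c w' →
      ¬ G.Adj w w' ∧ ¬ G.Adj w (φ w') ∧ ¬ G.Adj (φ w) w' ∧ ¬ G.Adj (φ w) (φ w'))
    (hrep : ∀ w ∈ J₀, ∃ w' ∈ J, w' ∉ J₀ ∧ c w' = c w)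
    (l : List V) (hl : l.Nodup) (hlv : ∀ w, w ∈ l ↔ G.Adj v w)
    (hF : ∀ (i : ℕ) (hi : i < l.length), #(farConflicts G v l[i]) + i ≤ 21 + #J₀) :
    ∃ γ : Sym2 V → Fin 22, IsStrongEdgeColoring G γ := by
  have hst : ∀ w ∈ J, ∀ w' ∈ J, ∀ u, u ∈ s(w, φ w) → u ∈ s(w', φ w') → w = w' := by
    intro w hw w' hw' u hu hu'
    have h₁ := hJ w hw
    have h₂ := hJ w' hw'
    have h₃ := hφ w hw w' hw'
    simp only [Sym2.mem_iff] at hu hu'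
    grind
  set P : Finset (Sym2 V) := J.image fun w ↦ s(w, φ w) with hPdef
  set E : Finset (Sym2 V) := {f ∈ G.edgeFinset | v ∉ f} with hE
  have hPE : P ⊆ E := by
    intro p hp
    obtain ⟨w, hw, rfl⟩ := mem_image.1 hp
    obtain ⟨h₁, h₂, h₃, -⟩ := hJ w hw
    simp [hE, h₂, h₁.ne, h₃.symm]
  -- the precolouring
  obtain ⟨κ, hκ⟩ : ∃ κ : Sym2 V → Fin 22, ∀ w ∈ J, κ s(w, φ w) = c w := by
    refine ⟨fun e ↦ if h : ∃ w ∈ J, s(w, φ w) = e then c h.choose else 0, fun w hw ↦ ?_⟩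
    have h : ∃ w' ∈ J, s(w', φ w') = s(w, φ w) := ⟨w, hw, rfl⟩
    refine (dif_pos h).trans ?_
    obtain ⟨h₁, h₂⟩ := h.choose_spec
    exact congrArg c (hst _ h₁ _ hw h.choose (Sym2.mem_mk_left _ _)
      (h₂.subst (motive := fun e ↦ h.choose ∈ e) (Sym2.mem_mk_left _ _)))
  have hPκ : IsPartialColoring G P κ := by
    intro e he f hf hne hef
    obtain ⟨w, hw, rfl⟩ := mem_image.1 he
    obtain ⟨w', hw', rfl⟩ := mem_image.1 hf
    have hww : w ≠ w' := by rintro rfl; exact hne rfl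
    rw [hκ w hw, hκ w' hw']
    intro hcc
    obtain ⟨h₁, h₂, h₃, h₄⟩ := hc w hw w' hw' hww hcc
    rcases hef with ⟨z, hz, hz'⟩ | ⟨x, hx, y, hy, hxy⟩
    · exact hww (hst w hw w' hw' z hz hz')
    · simp only [Sym2.mem_iff] at hx hy
      rcases hx with rfl | rfl <;> rcases hy with rfl | rfl <;> contradiction
  -- all edges avoiding the root
  obtain ⟨γ, hγP, hγ⟩ := hPκ.exists_union (E \ P) disjoint_sdiff (by
    intro T hT hTne
    have hTE : ∀ f ∈ T, f ∈ G.edgeSet ∧ v ∉ f := fun f hf ↦ by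
      simpa [hE] using (mem_sdiff.1 (hT hf)).1
    obtain ⟨t, ht, htmin⟩ := exists_min_image ({t | ∃ e ∈ T, t ∈ e} : Finset V) (G.dist v) (by
      obtain ⟨e, he⟩ := hTne
      exact ⟨e.out.1, mem_filter.2 ⟨mem_univ _, e, he, Sym2.out_fst_mem e⟩⟩)
    simp only [mem_filter, mem_univ, true_and] at ht htmin
    obtain ⟨e, heT, hte⟩ := ht
    obtain ⟨y, rfl⟩ := Sym2.mem_iff_exists.1 hte
    obtain ⟨hty, hve⟩ := hTE _ heT
    rw [SimpleGraph.mem_edgeSet] at hty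
    have htv : v ≠ t := by rintro rfl; simp at hve
    obtain ⟨u, hut, hu⟩ : ∃ u, G.Adj t u ∧ G.dist v u < G.dist v t := by
      obtain ⟨p, hp⟩ := (hG t v).exists_walk_length_eq_dist
      cases p with
      | nil => exact absurd rfl htv
      | @cons _ u _ h p =>
        refine ⟨u, h, ?_⟩
        rw [SimpleGraph.dist_comm, SimpleGraph.dist_comm (u := v) (v := t), ← hp]
        have := SimpleGraph.dist_le p
        simp only [SimpleGraph.Walk.length_cons]
        omega
    have huT : ∀ f ∈ T, u ∉ f := fun f hf huf ↦ absurd (htmin u ⟨f, hf, huf⟩) (by omega)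
    refine ⟨_, heT, ?_⟩
    have hsub : {f ∈ P ∪ T | f ≠ s(t, y) ∧ Conflict G s(t, y) f} ⊆
        {f ∈ P | u ∈ f} ∪ (((G.neighborFinset t).erase y).erase u ∪
          (G.neighborFinset y).erase t).biUnion (edgesAvoiding G v) := by
      intro f hf
      simp only [mem_filter, mem_union] at hf
      obtain ⟨hfPT, hfne, hfc⟩ := hf
      have hfE : f ∈ G.edgeSet ∧ v ∉ f := by
        rcases hfPT with hf | hf
        · simpa [hE] using hPE hf
        · exact hTE f hf
      obtain ⟨p, hp, h₁, h₂, h₃⟩ := exists_mem_of_conflict hty hfE.1 hfne hfc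
      simp only [mem_union, mem_biUnion, mem_filter, mem_erase, SimpleGraph.mem_neighborFinset,
        mem_edgesAvoiding]
      by_cases huf : u ∈ f
      · exact Or.inl ⟨hfPT.resolve_right fun h ↦ huT f h huf, huf⟩
      · have hpu : p ≠ u := by rintro rfl; exact huf hp
        exact Or.inr ⟨p, by tauto, hfE.1, hp, hfE.2⟩
    have hPu : #{f ∈ P | u ∈ f} ≤ 1 := by
      refine card_le_one.2 fun f hf g hg ↦ ?_
      simp only [mem_filter, hPdef, mem_image] at hf hg
      obtain ⟨⟨w, hw, rfl⟩, huw⟩ := hf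
      obtain ⟨⟨w', hw', rfl⟩, huw'⟩ := hg
      rw [hst w hw w' hw' u huw huw']
    have hyu : y ≠ u := by rintro rfl; exact huT _ heT (by simp)
    have hcard : #(((G.neighborFinset t).erase y).erase u ∪ (G.neighborFinset y).erase t) ≤ 5 := by
      refine (card_union_le _ _).trans ?_
      rw [card_erase_of_mem (by simp [hut, hyu.symm]), card_erase_of_mem (by simpa using hty),
        card_erase_of_mem (by simpa using hty.symm), SimpleGraph.card_neighborFinset_eq_degree,
        SimpleGraph.card_neighborFinset_eq_degree]
      have := hdeg t
      have := hdeg y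
      omega
    have h₁ := (card_le_card hsub).trans (card_union_le _ _)
    have h₂ := card_biUnion_le_card_mul (((G.neighborFinset t).erase y).erase u ∪
      (G.neighborFinset y).erase t) _ 4 fun p _ ↦ card_edgesAvoiding_le hdeg v p
    simp only [Fintype.card_fin]
    omega)
  rw [union_sdiff_of_subset hPE] at hγ
  -- the edges at the root
  set Q : Finset (Sym2 V) := J₀.image fun w ↦ s(w, φ w) with hQdef
  have hQ : #Q = #J₀ := card_image_of_injOn fun w hw w' hw' h ↦
    hst w (hJ₀ hw) w' (hJ₀ hw') w (by simp) (h ▸ by simp)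
  have hPF : ∀ w ∈ J, ∀ w', G.Adj v w' → s(w, φ w) ∈ farConflicts G v w' := by
    intro w hw w' hw'
    have h₁ := hPE (mem_image_of_mem (fun w ↦ s(w, φ w)) hw)
    rw [hE, mem_filter] at h₁
    exact mem_filter.2 ⟨h₁.1, h₁.2, Or.inr ⟨v, by simp, w, by simp, (hJ w hw).1⟩⟩
  have hseen : ∀ w, G.Adj v w →
      #({f ∈ E | Conflict G s(v, w) f}.image γ) + #J₀ ≤ #(farConflicts G v w) := by
    intro w hw
    have hsub : {f ∈ E | Conflict G s(v, w) f}.image γ ⊆ (farConflicts G v w \ Q).image γ := by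
      intro a ha
      obtain ⟨f, hf, rfl⟩ := mem_image.1 ha
      by_cases hfQ : f ∈ Q
      · obtain ⟨x, hx, rfl⟩ := mem_image.1 hfQ
        obtain ⟨x', hx', hx₀, hxx⟩ := hrep x hx
        refine mem_image.2 ⟨s(x', φ x'), mem_sdiff.2 ⟨hPF x' hx' w hw, fun h ↦ ?_⟩, ?_⟩
        · obtain ⟨z, hz, hzx⟩ := mem_image.1 h
          have : z = x' := hst z (hJ₀ hz) x' hx' z (by simp) (hzx ▸ by simp)
          exact hx₀ (this ▸ hz)
        · rw [hγP _ (mem_image_of_mem _ hx'), hγP _ (mem_image_of_mem _ (hJ₀ hx)), hκ _ hx',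
            hκ _ (hJ₀ hx), hxx]
      · refine mem_image_of_mem γ (mem_sdiff.2 ⟨?_, hfQ⟩)
        simpa [farConflicts, hE, and_assoc] using hf
    have hQF : Q ⊆ farConflicts G v w := by
      intro f hf
      obtain ⟨x, hx, rfl⟩ := mem_image.1 hf
      exact hPF x (hJ₀ hx) w hw
    have h₁ := (card_le_card hsub).trans card_image_le
    have h₂ := card_sdiff_add_card_eq_card hQF
    omega
  obtain ⟨γ', hγ'⟩ := hγ.exists_union_list (l.map fun w ↦ s(v, w))
    (hl.map fun a b h ↦ Sym2.congr_right.1 h)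
    (fun e he ↦ by
      obtain ⟨w, -, rfl⟩ := List.mem_map.1 he
      simp [hE])
    (fun i hi ↦ by
      have hi' : i < l.length := by simpa using hi
      have h₁ := hseen l[i] ((hlv _).1 (List.getElem_mem hi'))
      have h₂ := hF i hi'
      rw [List.getElem_map, Fintype.card_fin]
      omega)
  have hall : ∀ e ∈ G.edgeSet, e ∈ E ∪ (l.map fun w ↦ s(v, w)).toFinset := by
    intro e he
    by_cases hve : v ∈ e
    · obtain ⟨w, rfl⟩ := Sym2.mem_iff_exists.1 hve
      exact mem_union_right _ (List.mem_toFinset.2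
        (List.mem_map.2 ⟨w, (hlv w).2 (by simpa using he), rfl⟩))
    · exact mem_union_left _ (by simp [hE, hve, he])
  exact ⟨γ', fun e he f hf hne hef ↦ hγ' e (hall e he) f (hall f hf) hne hef⟩

/-- A bound that needs no structure when the root has degree at most three. -/
theorem exists_coloring_of_degree_le_three (hG : G.Preconnected) (hdeg : ∀ v, G.degree v ≤ 4)
    {v : V} (hv : G.degree v ≤ 3) : ∃ γ : Sym2 V → Fin 22, IsStrongEdgeColoring G γ := by
  refine exists_coloring_of_root hG hdeg v ∅ ∅ id (fun _ ↦ 0) (by simp) (by simp) (by simp)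
    (by simp) (by simp) (G.neighborFinset v).toList (nodup_toList _) (by simp) fun i hi ↦ ?_
  have hvw : G.Adj v (G.neighborFinset v).toList[i] := by
    have := List.getElem_mem hi
    rwa [mem_toList, SimpleGraph.mem_neighborFinset] at this
  have h₁ := (card_le_card (farConflicts_subset hvw)).trans (card_union_le _ _)
  have h₂ := card_biUnion_left_le hdeg hvw
  have h₃ := card_biUnion_right_le hdeg hvw
  rw [length_toList, SimpleGraph.card_neighborFinset_eq_degree] at hi
  omega

theorem exists_other_neighbors {v a b : V} (hv : G.degree v = 4) (ha : G.Adj v a)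
    (hb : G.Adj v b) (hab : a ≠ b) :
    ∃ c d, [c, d, a, b].Nodup ∧ ∀ w, w ∈ [c, d, a, b] ↔ G.Adj v w := by
  have h : #(((G.neighborFinset v).erase a).erase b) = 2 := by
    rw [card_erase_of_mem (by simp [hb, hab.symm]), card_erase_of_mem (by simpa using ha),
      SimpleGraph.card_neighborFinset_eq_degree, hv]
  obtain ⟨c, d, hcd, h⟩ := card_eq_two.1 h
  have hmem : ∀ w, w ∈ ((G.neighborFinset v).erase a).erase b ↔ w = c ∨ w = d := by simp [h]
  simp only [mem_erase, SimpleGraph.mem_neighborFinset] at hmem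
  refine ⟨c, d, ?_, fun w ↦ ?_⟩
  · have := (hmem c).2 (Or.inl rfl)
    have := (hmem d).2 (Or.inr rfl)
    simp [hcd, hab]
    tauto
  · have := hmem w
    simp only [List.mem_cons, List.not_mem_nil, or_false]
    grind

theorem exists_coloring_of_triangle (hG : G.Preconnected) (hreg : ∀ v, G.degree v = 4)
    {v a b : V} (ha : G.Adj v a) (hb : G.Adj v b) (hab : G.Adj a b) :
    ∃ γ : Sym2 V → Fin 22, IsStrongEdgeColoring G γ := by
  have hdeg : ∀ v, G.degree v ≤ 4 := fun v ↦ (hreg v).le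
  obtain ⟨c, d, hnd, hl⟩ := exists_other_neighbors (hreg v) ha hb hab.ne
  have hc : G.Adj v c := (hl c).1 (by simp)
  have hd : G.Adj v d := (hl d).1 (by simp)
  have htri : ∀ a b, G.Adj v a → G.Adj v b → G.Adj a b → #(farConflicts G v a) ≤ 17 := by
    intro a b ha hb hab
    have hsub : farConflicts G v a ⊆ ((G.neighborFinset v).erase a).biUnion (edgesAvoiding G v) ∪
        (((G.neighborFinset a).erase v).erase b).biUnion (edgesAvoiding G v) := by
      refine (farConflicts_subset ha).trans (union_subset subset_union_left fun f hf ↦ ?_)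
      obtain ⟨p, hp, hf⟩ := mem_biUnion.1 hf
      by_cases hpb : p = b
      · subst hpb
        exact mem_union_left _ (mem_biUnion.2 ⟨p, by simp [hb, hab.ne'], hf⟩)
      · exact mem_union_right _ (mem_biUnion.2 ⟨p, mem_erase.2 ⟨hpb, hp⟩, hf⟩)
    have h₁ := (card_le_card hsub).trans (card_union_le _ _)
    have h₂ := card_biUnion_left_le hdeg ha
    have h₃ := card_biUnion_le_card_mul (((G.neighborFinset a).erase v).erase b)
      (edgesAvoiding G v) 4 fun p _ ↦ card_edgesAvoiding_le hdeg v p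
    rw [card_erase_of_mem (by simp [hab, hb.ne']), card_erase_of_mem (by simpa using ha.symm),
      SimpleGraph.card_neighborFinset_eq_degree, hreg] at h₃
    rw [hreg] at h₂
    omega
  have hd' : #(farConflicts G v d) ≤ 20 := by
    have h₁ := (card_le_card (farConflicts_subset hd)).trans (card_union_le _ _)
    have h₃ := card_biUnion_right_le hdeg hd
    have hsub : ((G.neighborFinset v).erase d).biUnion (edgesAvoiding G v) ⊆
        edgesAvoiding G v c ∪ (edgesAvoiding G v a ∪ (edgesAvoiding G v b).erase s(a, b)) := by
      intro f hf
      simp only [mem_biUnion, mem_erase, SimpleGraph.mem_neighborFinset] at hf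
      obtain ⟨p, ⟨hpd, hp⟩, hf⟩ := hf
      have := (hl p).2 hp
      simp only [List.mem_cons, List.not_mem_nil, or_false] at this
      have hab' : s(a, b) ∈ edgesAvoiding G v a := by
        simp [mem_edgesAvoiding, hab, ha.ne, hb.ne]
      simp only [mem_union, mem_erase]
      rcases this with rfl | rfl | rfl | rfl
      · exact Or.inl hf
      · exact absurd rfl hpd
      · exact Or.inr (Or.inl hf)
      · by_cases hfa : f = s(a, p)
        · exact Or.inr (Or.inl (hfa ▸ hab'))
        · exact Or.inr (Or.inr ⟨hfa, hf⟩)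
    have h₂ := (card_le_card hsub).trans ((card_union_le _ _).trans
      (Nat.add_le_add_left (card_union_le _ _) _))
    rw [card_erase_of_mem (by simp [mem_edgesAvoiding, hab, ha.ne, hb.ne])] at h₂
    have := card_edgesAvoiding_le_of_adj hdeg ha
    have := card_edgesAvoiding_le_of_adj hdeg hb
    have := card_edgesAvoiding_le_of_adj hdeg hc
    omega
  refine exists_coloring_of_root hG hdeg v ∅ ∅ id (fun _ ↦ 0) (by simp) (by simp) (by simp)
    (by simp) (by simp) [c, d, a, b] hnd hl fun i hi ↦ ?_
  have h₁ := (card_le_card (farConflicts_subset hc)).trans (card_union_le _ _)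
  have h₂ := card_biUnion_left_le hdeg hc
  have h₃ := card_biUnion_right_le hdeg hc
  rw [hreg] at h₂
  have h₄ := htri a b ha hb hab
  have h₅ := htri b a hb ha hab.symm
  simp only [List.length_cons, List.length_nil] at hi
  interval_cases i <;> simp <;> omega

/-- The pairs `(w', x)` for which `v, w, x, w'` is a cycle through the edge `s(v, w)`. -/
noncomputable def fourCycles (G : SimpleGraph V) (v w : V) : Finset (V × V) :=
  {p ∈ (G.neighborFinset v).erase w ×ˢ (G.neighborFinset w).erase v | G.Adj p.1 p.2}

theorem mem_fourCycles {v w w' x : V} : (w', x) ∈ fourCycles G v w ↔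
    (w' ≠ w ∧ G.Adj v w') ∧ (x ≠ v ∧ G.Adj w x) ∧ G.Adj w' x := by
  simp [fourCycles, and_assoc]

theorem card_farConflicts_add_le (hreg : ∀ v, G.degree v = 4)
    (htri : ∀ a b c, G.Adj a b → G.Adj b c → ¬ G.Adj a c) {v w : V} (h : G.Adj v w) :
    #(farConflicts G v w) + #(fourCycles G v w) ≤ 21 := by
  have hdeg : ∀ v, G.degree v ≤ 4 := fun v ↦ (hreg v).le
  have h₁ := card_le_card (farConflicts_subset h)
  have h₂ := card_biUnion_left_le hdeg h
  have h₃ := card_biUnion_right_le hdeg h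
  have h₄ := card_union_add_card_inter (((G.neighborFinset v).erase w).biUnion (edgesAvoiding G v))
    (((G.neighborFinset w).erase v).biUnion (edgesAvoiding G v))
  have h₅ : #(fourCycles G v w) ≤
      #(((G.neighborFinset v).erase w).biUnion (edgesAvoiding G v) ∩
        ((G.neighborFinset w).erase v).biUnion (edgesAvoiding G v)) := by
    refine card_le_card_of_injOn (fun p ↦ s(p.1, p.2)) ?_ ?_
    · rintro ⟨w', x⟩ hp
      obtain ⟨⟨h₁, h₂⟩, ⟨h₃, h₄⟩, h₅⟩ := mem_fourCycles.1 hp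
      have : s(w', x) ∈ G.edgeSet ∧ v ∉ s(w', x) := by simp [h₅, h₃.symm, h₂.ne]
      simp only [coe_inter, Set.mem_inter_iff, mem_coe, mem_biUnion, mem_erase,
        SimpleGraph.mem_neighborFinset, mem_edgesAvoiding]
      exact ⟨⟨w', ⟨h₁, h₂⟩, this.1, by simp, this.2⟩, ⟨x, ⟨h₃, h₄⟩, this.1, by simp, this.2⟩⟩
    · rintro ⟨w', x⟩ hp ⟨w'', x'⟩ hp' heq
      obtain ⟨⟨-, h₂⟩, ⟨-, -⟩, -⟩ := mem_fourCycles.1 hp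
      obtain ⟨⟨-, -⟩, ⟨-, h₄⟩, -⟩ := mem_fourCycles.1 hp'
      rcases Sym2.eq_iff.1 heq with ⟨rfl, rfl⟩ | ⟨rfl, rfl⟩
      · rfl
      · exact absurd h₂ (htri _ _ _ h h₄)
  rw [hreg] at h₂
  omega

/-- `exists_coloring_of_root` for triangle-free `4`-regular graphs. -/
theorem exists_coloring_of_stubs (hG : G.Preconnected) (hreg : ∀ v, G.degree v = 4)
    (htri : ∀ a b c, G.Adj a b → G.Adj b c → ¬ G.Adj a c) {v w₁ w₂ w₃ w₄ : V}
    (hnd : [w₁, w₂, w₃, w₄].Nodup) (hl : ∀ w, w ∈ [w₁, w₂, w₃, w₄] ↔ G.Adj v w)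
    (J J₀ : Finset V) (φ : V → V) (c : V → Fin 22) (hJ₀ : J₀ ⊆ J)
    (hJ : ∀ w ∈ J, G.Adj v w ∧ G.Adj w (φ w) ∧ φ w ≠ v)
    (hφ : ∀ w ∈ J, ∀ w' ∈ J, φ w = φ w' → w = w')
    (hc : ∀ w ∈ J, ∀ w' ∈ J, w ≠ w' → c w = c w' →
      ¬ G.Adj w (φ w') ∧ ¬ G.Adj (φ w) w' ∧ ¬ G.Adj (φ w) (φ w'))
    (hrep : ∀ w ∈ J₀, ∃ w' ∈ J, w' ∉ J₀ ∧ c w' = c w)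
    (h₂ : 1 ≤ #(fourCycles G v w₂) + #J₀) (h₃ : 2 ≤ #(fourCycles G v w₃) + #J₀)
    (h₄ : 3 ≤ #(fourCycles G v w₄) + #J₀) :
    ∃ γ : Sym2 V → Fin 22, IsStrongEdgeColoring G γ := by
  refine exists_coloring_of_root hG (fun v ↦ (hreg v).le) v J J₀ φ c hJ₀
    (fun w hw ↦ ⟨(hJ w hw).1, (hJ w hw).2.1, (hJ w hw).2.2,
      htri _ _ _ (hJ w hw).1 (hJ w hw).2.1⟩) hφ
    (fun w hw w' hw' hne hcc ↦ ⟨fun h ↦ htri _ _ _ (hJ w hw).1 h (hJ w' hw').1,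
      hc w hw w' hw' hne hcc⟩) hrep _ hnd hl fun i hi ↦ ?_
  have hb : ∀ w ∈ [w₁, w₂, w₃, w₄], #(farConflicts G v w) + #(fourCycles G v w) ≤ 21 :=
    fun w hw ↦ card_farConflicts_add_le hreg htri ((hl w).1 hw)
  have := hb w₁ (by simp)
  have := hb w₂ (by simp)
  have := hb w₃ (by simp)
  have := hb w₄ (by simp)
  simp only [List.length_cons, List.length_nil] at hi
  interval_cases i <;> simp <;> omega

theorem card_neighborFinset_erase (hreg : ∀ v, G.degree v = 4) {v w : V} (h : G.Adj v w) :
    #((G.neighborFinset w).erase v) = 3 := by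
  rw [card_erase_of_mem (by simpa using h.symm), SimpleGraph.card_neighborFinset_eq_degree, hreg]

/-- The second neighbourhoods of two neighbours of `v` span a complete bipartite graph. -/
theorem exists_coloring_of_bipartite (hG : G.Preconnected) (hreg : ∀ v, G.degree v = 4)
    (htri : ∀ a b c, G.Adj a b → G.Adj b c → ¬ G.Adj a c) {v w w' : V} (hw : G.Adj v w)
    (hw' : G.Adj v w')
    (h : ∀ x ∈ (G.neighborFinset w).erase v, ∀ y ∈ (G.neighborFinset w').erase v, G.Adj x y) :
    ∃ γ : Sym2 V → Fin 22, IsStrongEdgeColoring G γ := by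
  have hX := card_neighborFinset_erase hreg hw
  have hY := card_neighborFinset_erase hreg hw'
  obtain ⟨x, hx⟩ : ((G.neighborFinset w).erase v).Nonempty := card_pos.1 (by omega)
  have hxw : G.Adj x w := ((SimpleGraph.mem_neighborFinset _ _ _).1 (mem_erase.1 hx).2).symm
  have hcyc : ∀ y ∈ (G.neighborFinset w').erase v, 3 ≤ #(fourCycles G x y) := by
    intro y hy
    have hsub : ((G.neighborFinset w').erase v).erase y ×ˢ ((G.neighborFinset w).erase v).erase x ⊆
        fourCycles G x y := by
      rintro ⟨y', x'⟩ hp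
      obtain ⟨hy', hx'⟩ := mem_product.1 hp
      obtain ⟨hyy, hy'⟩ := mem_erase.1 hy'
      obtain ⟨hxx, hx'⟩ := mem_erase.1 hx'
      exact mem_fourCycles.2 ⟨⟨hyy, h x hx y' hy'⟩, ⟨hxx, (h x' hx' y hy).symm⟩,
        (h x' hx' y' hy').symm⟩
    have := card_le_card hsub
    rw [card_product, card_erase_of_mem hy, card_erase_of_mem hx, hX, hY] at this
    omega
  obtain ⟨a, b, c, hab, hac, hbc, habc⟩ := card_eq_three.1 hY
  rw [habc] at hcyc
  have hwY : w ∉ (G.neighborFinset w').erase v := by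
    intro hwY
    exact htri _ _ _ hw' (by simpa using (mem_erase.1 hwY).2) hw
  have hN : insert w ((G.neighborFinset w').erase v) = G.neighborFinset x := by
    refine eq_of_subset_of_card_le (insert_subset (by simpa using hxw) fun y hy ↦ ?_) ?_
    · simpa using h x hx y hy
    · rw [card_insert_of_notMem hwY, hY, SimpleGraph.card_neighborFinset_eq_degree, hreg]
  refine exists_coloring_of_stubs hG hreg htri (v := x) (w₁ := w) (w₂ := a) (w₃ := b) (w₄ := c)
    ?_ (fun u ↦ ?_) ∅ ∅ id (fun _ ↦ 0) (by simp) (by simp) (by simp) (by simp) (by simp)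
    ?_ ?_ ?_
  · rw [habc] at hwY
    simp at hwY ⊢
    tauto
  · rw [← SimpleGraph.mem_neighborFinset, ← hN, habc]
    simp
  · have := hcyc a (by simp)
    omega
  · have := hcyc b (by simp)
    omega
  · have := hcyc c (by simp)
    omega

/-- Some edge lies in two cycles of length four. -/
theorem exists_coloring_of_two_le_card_fourCycles (hG : G.Preconnected)
    (hreg : ∀ v, G.degree v = 4) (htri : ∀ a b c, G.Adj a b → G.Adj b c → ¬ G.Adj a c) {v w : V}
    (hw : G.Adj v w) (hcard : 2 ≤ #(fourCycles G v w)) :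
    ∃ γ : Sym2 V → Fin 22, IsStrongEdgeColoring G γ := by
  obtain ⟨⟨w', z⟩, hz⟩ : (fourCycles G v w).Nonempty := card_pos.1 (by omega)
  obtain ⟨⟨hne, hw'⟩, ⟨hzv, hwz⟩, hwz'⟩ := mem_fourCycles.1 hz
  have hcard' : 1 ≤ #(fourCycles G v w') :=
    card_pos.2 ⟨(w, z), mem_fourCycles.2 ⟨⟨hne.symm, hw⟩, ⟨hzv, hwz'⟩, hwz⟩⟩
  obtain ⟨c, d, hnd, hl⟩ := exists_other_neighbors (hreg v) hw' hw hne
  by_cases hpair : ∃ a b x y, a ≠ b ∧ G.Adj v a ∧ G.Adj v b ∧ (x ≠ v ∧ G.Adj a x) ∧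
      (y ≠ v ∧ G.Adj b y) ∧ ¬ G.Adj x b ∧ ¬ G.Adj a y ∧ ¬ G.Adj x y
  · obtain ⟨a, b, x, y, hab, ha, hb, ⟨hxv, hax⟩, ⟨hyv, hby⟩, hxb, hay, hxy⟩ := hpair
    have hxyne : x ≠ y := by rintro rfl; exact hay hax
    have hφb : (if b = a then x else y) = y := if_neg hab.symm
    refine exists_coloring_of_stubs hG hreg htri hnd hl {a, b} {b} (fun u ↦ if u = a then x else y)
      (fun _ ↦ 0) (by simp) ?_ ?_ ?_ ?_ ?_ ?_ ?_
    · simp [*]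
    · simp [hφb, hxyne, hxyne.symm]
    · simp [hab, hab.symm, hxb, hay, hxy, G.adj_comm b x, G.adj_comm y a, G.adj_comm y x]
    · simp [hab]
    all_goals
      rw [card_singleton]
      omega
  · push Not at hpair
    by_cases hcommon : ∀ a b, a ≠ b → G.Adj v a → G.Adj v b → ∃ x, x ≠ v ∧ G.Adj a x ∧ G.Adj b x
    · have hthree : ∀ b, G.Adj v b → 3 ≤ #(fourCycles G v b) := by
        intro b hb
        have hsub : (G.neighborFinset v).erase b ⊆ (fourCycles G v b).image Prod.fst := by
          intro a ha
          simp only [mem_erase, SimpleGraph.mem_neighborFinset] at ha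
          obtain ⟨x, hx, hax, hbx⟩ := hcommon a b ha.1 ha.2 hb
          exact mem_image.2 ⟨(a, x), mem_fourCycles.2 ⟨ha, ⟨hx, hbx⟩, hax⟩, rfl⟩
        have := (card_le_card hsub).trans card_image_le
        rwa [card_neighborFinset_erase hreg hb.symm] at this
      refine exists_coloring_of_stubs hG hreg htri hnd hl ∅ ∅ id (fun _ ↦ 0) (by simp) (by simp)
        (by simp) (by simp) (by simp) ?_ ?_ ?_
      · have := hthree d ((hl d).1 (by simp))
        omega
      · have := hthree w' hw'
        omega
      · have := hthree w hw
        omega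
    · push Not at hcommon
      obtain ⟨a, b, hab, ha, hb, hno⟩ := hcommon
      refine exists_coloring_of_bipartite hG hreg htri ha hb fun x hx y hy ↦ ?_
      simp only [mem_erase, SimpleGraph.mem_neighborFinset] at hx hy
      exact hpair a b x y hab ha hb hx hy (fun h ↦ hno x hx.1 hx.2 h.symm)
        (fun h ↦ hno y hy.1 h hy.2)

/-- If no edge is in two cycles of length four, then two pairs of vertices with a common neighbour
on one side are not completely joined. -/
theorem exists_not_adj (hone : ∀ v w, G.Adj v w → #(fourCycles G v w) ≤ 1) {p : V}
    {X Y : Finset V} (hX : 1 < #X) (hY : 1 < #Y) (hpX : ∀ x ∈ X, G.Adj p x) (hpY : p ∉ Y) :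
    ∃ x ∈ X, ∃ y ∈ Y, ¬ G.Adj x y := by
  by_contra! h
  obtain ⟨a, ha, b, hb, hab⟩ := one_lt_card.1 hX
  obtain ⟨c, hc, d, hd, hcd⟩ := one_lt_card.1 hY
  refine absurd (hone p a (hpX a ha)) (not_le.2 (one_lt_card.2 ⟨(b, c), ?_, (b, d), ?_, ?_⟩))
  · exact mem_fourCycles.2 ⟨⟨hab.symm, hpX b hb⟩, ⟨by rintro rfl; exact hpY hc, h a ha c hc⟩,
      h b hb c hc⟩
  · exact mem_fourCycles.2 ⟨⟨hab.symm, hpX b hb⟩, ⟨by rintro rfl; exact hpY hd, h a ha d hd⟩,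
      h b hb d hd⟩
  · simpa using hcd

/-- There is a cycle of length four, but no edge lies in two of them. -/
theorem exists_coloring_of_fourCycle (hG : G.Preconnected)
    (hreg : ∀ v, G.degree v = 4) (htri : ∀ a b c, G.Adj a b → G.Adj b c → ¬ G.Adj a c)
    (hone : ∀ v w, G.Adj v w → #(fourCycles G v w) ≤ 1) {v a a' z : V} (ha : G.Adj v a)
    (hz : (a', z) ∈ fourCycles G v a) : ∃ γ : Sym2 V → Fin 22, IsStrongEdgeColoring G γ := by
  obtain ⟨⟨hne, ha'⟩, ⟨hzv, haz⟩, haz'⟩ := mem_fourCycles.1 hz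
  have hz' : (a, z) ∈ fourCycles G v a' := mem_fourCycles.2 ⟨⟨hne.symm, ha⟩, ⟨hzv, haz'⟩, haz⟩
  obtain ⟨b, b', hnd, hl⟩ := exists_other_neighbors (hreg v) ha' ha hne
  have hb : G.Adj v b := (hl b).1 (by simp)
  have hb' : G.Adj v b' := (hl b').1 (by simp)
  simp only [List.nodup_cons, List.mem_cons, List.not_mem_nil, or_false, not_or,
    List.nodup_nil, not_false_eq_true, and_true] at hnd
  obtain ⟨⟨hbb, hba', hba⟩, ⟨hba2, hba1⟩, -⟩ := hnd
  -- the only common neighbours of `a` or `a'` and another neighbour of `v` are `v` and `z`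
  have hcommon : ∀ u x, u ≠ a → u ≠ a' → G.Adj v u → x ≠ v → G.Adj u x →
      ¬ G.Adj a x ∧ ¬ G.Adj a' x := by
    refine fun u x hua hua' hu hx hux ↦ ⟨fun h ↦ ?_, fun h ↦ ?_⟩
    · have h₁ := card_le_one.1 (hone v a ha) _ hz (u, x)
        (mem_fourCycles.2 ⟨⟨hua, hu⟩, ⟨hx, h⟩, hux⟩)
      exact hua' (congrArg Prod.fst h₁).symm
    · have h₁ := card_le_one.1 (hone v a' ha') _ hz' (u, x)
        (mem_fourCycles.2 ⟨⟨hua', hu⟩, ⟨hx, h⟩, hux⟩)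
      exact hua (congrArg Prod.fst h₁).symm
  have hcard {u : V} (hu : G.Adj v u) := card_neighborFinset_erase hreg hu
  have hcard' {u : V} (hu : G.Adj v u) (x : V) : 1 < #(((G.neighborFinset u).erase v).erase x) := by
    have := pred_card_le_card_erase (s := (G.neighborFinset u).erase v) (a := x)
    rw [hcard hu] at this
    omega
  obtain ⟨x, hx, y, hy, hxy⟩ := exists_not_adj hone (p := a) (X := (G.neighborFinset a).erase v)
    (Y := (G.neighborFinset b).erase v) (by rw [hcard ha]; omega) (by rw [hcard hb]; omega)
    (fun x hx ↦ by simpa using (mem_erase.1 hx).2)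
    (fun h ↦ htri v b a hb (by simpa using (mem_erase.1 h).2) ha)
  obtain ⟨x', hx', y', hy', hxy'⟩ := exists_not_adj hone (p := a')
    (X := ((G.neighborFinset a').erase v).erase x) (Y := ((G.neighborFinset b').erase v).erase y)
    (hcard' ha' x) (hcard' hb' y)
    (fun x hx ↦ by simpa using (mem_erase.1 (mem_erase.1 hx).2).2)
    (fun h ↦ htri v b' a' hb' (by simpa using (mem_erase.1 (mem_erase.1 h).2).2) ha')
  simp only [mem_erase, SimpleGraph.mem_neighborFinset] at hx hy hx' hy'
  obtain ⟨hy₁, hy₂⟩ := hcommon b y hba hba' hb hy.1 hy.2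
  obtain ⟨hy₁', hy₂'⟩ := hcommon b' y' hba1 hba2 hb' hy'.2.1 hy'.2.2
  have hbx : ¬ G.Adj b x := fun h ↦ (hcommon b x hba hba' hb hx.1 h).1 hx.2
  have hbx' : ¬ G.Adj b' x' := fun h ↦ (hcommon b' x' hba1 hba2 hb' hx'.2.1 h).2 hx'.2.2
  have n₁ : x ≠ y := by rintro rfl; exact hbx hy.2
  have n₂ : x ≠ y' := by rintro rfl; exact hy₁' hx.2
  have n₃ : x' ≠ y := by rintro rfl; exact hy₂ hx'.2.2
  have n₄ : x' ≠ y' := by rintro rfl; exact hbx' hy'.2.2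
  obtain ⟨φ, φa, φa', φb, φb'⟩ : ∃ φ : V → V, φ a = x ∧ φ a' = x' ∧ φ b = y ∧ φ b' = y' :=
    ⟨fun u ↦ if u = a then x else if u = a' then x' else if u = b then y else y', by
      simp [hne, hba, hba', hba1, hba2, Ne.symm hbb]⟩
  have hx'x := hx'.1
  have hy'y := hy'.1
  refine exists_coloring_of_stubs hG hreg htri (w₁ := b) (w₂ := b') (w₃ := a') (w₄ := a)
    (by simp; tauto) hl {a, a', b, b'} {b, b'} φ (fun u ↦ if u = a ∨ u = b then 0 else 1)
    (by intro u; simp; tauto) ?_ ?_ ?_ ?_ ?_ ?_ ?_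
  · simp [*]
  · simp [φa, φa', φb, φb', n₁, n₂, n₃, n₄, hx'x, hy'y, n₁.symm, n₂.symm, n₃.symm, n₄.symm,
      hx'x.symm, hy'y.symm]
  · simp [*, Ne.symm hba, Ne.symm hba1, Ne.symm hba', Ne.symm hba2, Ne.symm hbb,
      G.adj_comm x b, G.adj_comm y a, G.adj_comm y x, G.adj_comm x' b', G.adj_comm y' a',
      G.adj_comm y' x']
  · simp [hne, hba, hba1, hbb, Ne.symm hbb, Ne.symm hba, Ne.symm hba1,
      Ne.symm hba', Ne.symm hba2]
  all_goals rw [card_pair hbb]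
  · omega
  · omega
  · have : 0 < #(fourCycles G v a) := card_pos.2 ⟨_, hz⟩
    omega

/-- The girth is at least five. -/
theorem exists_coloring_of_fourCycles_eq_empty (hG : G.Preconnected)
    (hreg : ∀ v, G.degree v = 4) (htri : ∀ a b c, G.Adj a b → G.Adj b c → ¬ G.Adj a c)
    (hnone : ∀ v w, G.Adj v w → fourCycles G v w = ∅) (v : V) :
    ∃ γ : Sym2 V → Fin 22, IsStrongEdgeColoring G γ := by
  have hsq : ∀ x w y z, x ≠ w → y ≠ z → G.Adj w y → G.Adj w z → G.Adj x y → ¬ G.Adj x z := by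
    intro x w y z hxw hyz hy hz hxy hxz
    have : (z, x) ∈ fourCycles G w y :=
      mem_fourCycles.2 ⟨⟨hyz.symm, hz⟩, ⟨hxw, hxy.symm⟩, hxz.symm⟩
    rw [hnone w y hy] at this
    exact notMem_empty _ this
  obtain ⟨a, b, ha, hb, hab⟩ : ∃ a b, G.Adj v a ∧ G.Adj v b ∧ a ≠ b := by
    obtain ⟨a, ha, b, hb, hab⟩ := one_lt_card.1 (show 1 < #(G.neighborFinset v) by
      rw [SimpleGraph.card_neighborFinset_eq_degree, hreg]
      omega)
    exact ⟨a, b, by simpa using ha, by simpa using hb, hab⟩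
  obtain ⟨c, d, hnd, hl⟩ := exists_other_neighbors (hreg v) ha hb hab
  have hc : G.Adj v c := (hl c).1 (by simp)
  have hd : G.Adj v d := (hl d).1 (by simp)
  have hnd' := hnd
  simp only [List.nodup_cons, List.mem_cons, List.not_mem_nil, or_false, not_or,
    List.nodup_nil, not_false_eq_true, and_true] at hnd'
  obtain ⟨⟨hcd, hca, hcb⟩, ⟨hda, hdb⟩, -⟩ := hnd'
  obtain ⟨x, hx⟩ : ((G.neighborFinset a).erase v).Nonempty :=
    card_pos.1 (by rw [card_neighborFinset_erase hreg ha]; omega)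
  simp only [mem_erase, SimpleGraph.mem_neighborFinset] at hx
  set X : V → Finset V := fun u ↦ ((G.neighborFinset u).erase v).filter fun y ↦ ¬ G.Adj x y
  have hX : ∀ u, G.Adj v u → 1 < #(X u) := by
    intro u hu
    have h₁ : #(((G.neighborFinset u).erase v).filter fun y ↦ G.Adj x y) ≤ 1 := by
      refine card_le_one.2 fun y hy z hz ↦ ?_
      simp only [mem_filter, mem_erase, SimpleGraph.mem_neighborFinset] at hy hz
      by_contra hyz
      refine hsq x u y z ?_ hyz hy.1.2 hz.1.2 hy.2 hz.2
      rintro rfl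
      exact htri _ _ _ ha hx.2 hu
    have h₂ := card_filter_add_card_filter_not (s := (G.neighborFinset u).erase v)
      (fun y ↦ G.Adj x y)
    rw [card_neighborFinset_erase hreg hu] at h₂
    change 1 < #(((G.neighborFinset u).erase v).filter fun y ↦ ¬ G.Adj x y)
    omega
  have hmem : ∀ u y, y ∈ X u → y ≠ v ∧ G.Adj u y ∧ ¬ G.Adj x y := by
    intro u y hy
    simpa [X, and_assoc] using hy
  obtain ⟨y, hy, z, hz, t, ht, hyz, hyt, hzt⟩ := exists_independent_transversal htri hsq hb hc hd
    (hX b hb) (hX c hc) (hX d hd) (fun y hy ↦ (hmem b y hy).2.1) (fun y hy ↦ (hmem c y hy).2.1)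
    (fun y hy ↦ (hmem d y hy).2.1)
  obtain ⟨hyv, hby, hxy⟩ := hmem b y hy
  obtain ⟨hzv, hcz, hxz⟩ := hmem c z hz
  obtain ⟨htv, hdt, hxt⟩ := hmem d t ht
  obtain ⟨φ, φa, φb, φc, φd⟩ : ∃ φ : V → V, φ a = x ∧ φ b = y ∧ φ c = z ∧ φ d = t :=
    ⟨fun u ↦ if u = a then x else if u = b then y else if u = c then z else t, by
      simp [hab.symm, hca, hcb, hda, hdb, Ne.symm hcd]⟩
  have hφ : ∀ w ∈ ({a, b, c, d} : Finset V), G.Adj v w ∧ G.Adj w (φ w) ∧ φ w ≠ v := by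
    simp [*]
  have hfar : ∀ w w' u, G.Adj v w → G.Adj v w' → w ≠ w' → u ≠ v → G.Adj w u → ¬ G.Adj w' u :=
    fun w w' u hw hw' hne hu hwu hwu' ↦
      hsq u v w w' hu hne hw hw' hwu.symm hwu'.symm
  have hadj : ∀ w ∈ ({a, b, c, d} : Finset V), ∀ w' ∈ ({a, b, c, d} : Finset V),
      ¬ G.Adj (φ w) (φ w') := by
    simp [*, G.adj_comm y x, G.adj_comm z x, G.adj_comm t x, G.adj_comm z y, G.adj_comm t y,
      G.adj_comm t z]
  refine exists_coloring_of_stubs hG hreg htri hnd hl {a, b, c, d} {b, c, d} φ (fun _ ↦ 0)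
    (subset_insert _ _) hφ (fun w hw w' hw' h ↦ ?_) (fun w hw w' hw' hne _ ↦ ?_)
    (fun w _ ↦ ⟨a, by simp, by simp [hab, Ne.symm hca, Ne.symm hda], rfl⟩) ?_ ?_ ?_
  · by_contra hne
    obtain ⟨h₁, h₂, h₃⟩ := hφ w hw
    obtain ⟨h₁', h₂', h₃'⟩ := hφ w' hw'
    exact hfar w w' _ h₁ h₁' hne h₃ h₂ (h ▸ h₂')
  · obtain ⟨h₁, h₂, h₃⟩ := hφ w hw
    obtain ⟨h₁', h₂', h₃'⟩ := hφ w' hw'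
    exact ⟨hfar w' w _ h₁' h₁ hne.symm h₃' h₂',
      fun h ↦ hfar w w' _ h₁ h₁' hne h₃ h₂ h.symm, hadj w hw w' hw'⟩
  all_goals
    rw [card_insert_of_notMem (by simp [Ne.symm hcb, Ne.symm hdb]), card_pair hcd]
    omega

theorem exists_coloring_of_preconnected (hG : G.Preconnected) (hdeg : ∀ v, G.degree v ≤ 4) :
    ∃ γ : Sym2 V → Fin 22, IsStrongEdgeColoring G γ := by
  by_cases hreg : ∀ v, G.degree v = 4
  · by_cases htri : ∀ a b c, G.Adj a b → G.Adj b c → ¬ G.Adj a c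
    · by_cases hone : ∀ v w, G.Adj v w → #(fourCycles G v w) ≤ 1
      · by_cases hnone : ∀ v w, G.Adj v w → fourCycles G v w = ∅
        · cases isEmpty_or_nonempty V with
          | inl h => exact ⟨fun _ ↦ 0, fun e ↦ (h.false e.out.1).elim⟩
          | inr h => exact exists_coloring_of_fourCycles_eq_empty hG hreg htri hnone h.some
        · push Not at hnone
          obtain ⟨v, a, ha, ⟨a', z⟩, hz⟩ := hnone
          exact exists_coloring_of_fourCycle hG hreg htri hone ha hz
      · push Not at hone
        obtain ⟨v, w, hw, hcard⟩ := hone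
        exact exists_coloring_of_two_le_card_fourCycles hG hreg htri hw hcard
    · push Not at htri
      obtain ⟨a, b, c, hab, hbc, hac⟩ := htri
      exact exists_coloring_of_triangle hG hreg hab hac hbc
  · push Not at hreg
    obtain ⟨v, hv⟩ := hreg
    have := hdeg v
    exact exists_coloring_of_degree_le_three hG hdeg (v := v) (by omega)

end StrongEdgeColoring

/-- Cranston.  Every finite simple graph of maximum degree at most `4`
admits a strong edge-colouring using at most `22` colours. -/
theorem stmt_5 {V : Type*} [Fintype V] (G : SimpleGraph V) [DecidableRel G.Adj]
    (hdeg : ∀ v : V, G.degree v ≤ 4) :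
    ∃ γ : Sym2 V → Fin 22, IsStrongEdgeColoring G γ := by
  classical
  refine StrongEdgeColoring.exists_coloring_of_forall_component fun c ↦
    StrongEdgeColoring.exists_coloring_of_preconnected c.connected_toSimpleGraph.preconnected
      fun v ↦ le_trans ?_ (hdeg v)
  rw [← SimpleGraph.card_neighborFinset_eq_degree, ← SimpleGraph.card_neighborFinset_eq_degree]
  refine Finset.card_le_card_of_injOn Subtype.val (fun w hw ↦ ?_) Subtype.val_injective.injOn
  rw [Finset.mem_coe, SimpleGraph.mem_neighborFinset] at hw ⊢
  exact hw
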